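/- Let n, m be positive integers, Φ ∈ ℝ^{n×m}, A ∈ ℝ^{m×m}, and let M > 0 and γ > 0 satisfy ‖A‖ ≤ M and γ₀ := γM < 1. If Z ∈ ℝ^{n×m} satisfies Z = relu(γ·Z·A + Φ), then ‖Z‖_F ≤ ‖Φ‖_F / (1 − γ₀). -/

import Mathlib

open Matrix
open scoped Kronecker

/-- The ℓ2 operator norm of a real matrix. -/
noncomputable def l2OpNorm {ι κ : Type*} [Fintype ι] [Fintype κ] [DecidableEq κ]
    (A : Matrix ι κ ℝ) : ℝ :=
  ‖LinearMap.toContinuousLinearMap (Matrix.toEuclideanLin A)‖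

/-- The Frobenius norm of a real matrix. -/
noncomputable def frobNorm {ι κ : Type*} [Fintype ι] [Fintype κ] (A : Matrix ι κ ℝ) : ℝ :=
  Real.sqrt (∑ i, ∑ j, (A i j) ^ 2)

/-- Entrywise ReLU applied to a real matrix. -/
noncomputable def reluM {ι κ : Type*} (A : Matrix ι κ ℝ) : Matrix ι κ ℝ :=
  Matrix.of fun i j => max (A i j) 0

section Frob
attribute [local instance] Matrix.frobeniusNormedAddCommGroup Matrix.frobeniusNormedSpace

theorem frobNorm_eq_norm {n m : ℕ} (X : Matrix (Fin n) (Fin m) ℝ) : frobNorm X = ‖X‖ := by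
  rw [Matrix.frobenius_norm_def, frobNorm, Real.sqrt_eq_rpow]
  simp

theorem frobNorm_smul_add_le {n m : ℕ} (c : ℝ) (hc : 0 ≤ c) (X Y : Matrix (Fin n) (Fin m) ℝ) :
    frobNorm (c • X + Y) ≤ c * frobNorm X + frobNorm Y := by
  simp only [frobNorm_eq_norm]
  refine (norm_add_le _ _).trans ?_
  rw [norm_smul, Real.norm_of_nonneg hc]

end Frob

section Op
open scoped Matrix.Norms.L2Operator

theorem row_bound {m : ℕ} (A : Matrix (Fin m) (Fin m) ℝ) (M : ℝ) (hM : 0 < M)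
    (hAM : l2OpNorm A ≤ M) (z : Fin m → ℝ) :
    ∑ j, (z ᵥ* A) j ^ 2 ≤ M ^ 2 * ∑ j, z j ^ 2 := by
  have h0 : ‖Aᵀ‖ ≤ M := by
    rw [← Matrix.conjTranspose_eq_transpose_of_trivial, Matrix.l2_opNorm_conjTranspose]
    exact hAM
  have h1 := (Matrix.l2_opNorm_mulVec Aᵀ (WithLp.toLp 2 z)).trans
    (mul_le_mul_of_nonneg_right h0 (norm_nonneg _))
  have h2 := pow_le_pow_left₀ (norm_nonneg _) h1 2
  rw [mul_pow, EuclideanSpace.real_norm_sq_eq, EuclideanSpace.real_norm_sq_eq] at h2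
  simpa [Matrix.mulVec_transpose] using h2

end Op

theorem frobNorm_mul_le {n m : ℕ} (Z : Matrix (Fin n) (Fin m) ℝ) (A : Matrix (Fin m) (Fin m) ℝ)
    (M : ℝ) (hM : 0 < M) (hAM : l2OpNorm A ≤ M) :
    frobNorm (Z * A) ≤ M * frobNorm Z := by
  unfold frobNorm
  rw [← Real.sqrt_sq hM.le, ← Real.sqrt_mul (sq_nonneg M)]
  apply Real.sqrt_le_sqrt
  rw [Finset.mul_sum]
  refine Finset.sum_le_sum fun i _ => ?_
  have := row_bound A M hM hAM (Z i)
  simpa [Matrix.mul_apply, Matrix.vecMul, dotProduct] using this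

theorem frobNorm_reluM_le {n m : ℕ} (X : Matrix (Fin n) (Fin m) ℝ) :
    frobNorm (reluM X) ≤ frobNorm X := by
  unfold frobNorm
  apply Real.sqrt_le_sqrt
  refine Finset.sum_le_sum fun i _ => Finset.sum_le_sum fun j _ => ?_
  simp only [reluM, Matrix.of_apply]
  rcases max_cases (X i j) 0 with h | h <;> rw [h.1]
  nlinarith [sq_nonneg (X i j)]

/-- Any equilibrium point `Z = relu(γ·Z·A + Φ)` satisfies
`‖Z‖_F ≤ ‖Φ‖_F / (1 − γ·M)` when `‖A‖ ≤ M` and `γ·M < 1`. -/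
theorem equilibrium_frobenius_bound (n m : ℕ) (hn : 0 < n) (hm : 0 < m)
    (Φ : Matrix (Fin n) (Fin m) ℝ) (A : Matrix (Fin m) (Fin m) ℝ)
    (M γ : ℝ) (hM : 0 < M) (hγ : 0 < γ)
    (hAM : l2OpNorm A ≤ M) (hγ0 : γ * M < 1)
    (Z : Matrix (Fin n) (Fin m) ℝ) (hZ : Z = reluM (γ • (Z * A) + Φ)) :
    frobNorm Z ≤ frobNorm Φ / (1 - γ * M) := by
  rw [le_div_iff₀ (by linarith)]
  have h1 : frobNorm Z ≤ frobNorm (γ • (Z * A) + Φ) := by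
    have := frobNorm_reluM_le (γ • (Z * A) + Φ)
    rwa [← hZ] at this
  have h2 := frobNorm_smul_add_le γ hγ.le (Z * A) Φ
  have h3 := mul_le_mul_of_nonneg_left (frobNorm_mul_le Z A M hM hAM) hγ.le
  linarith
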